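/- The canonical height function h(i,j) = i·j on U is non-crossing, and for every U-tree T and every k ∈ {1,…,b}, the unique point y of g(T) satisfies y_k = Σ_{m=1}^{ℓ} i_m (j_m − j_{m+1}), where ℓ ≥ 1, i_1 ≥ ⋯ ≥ i_ℓ and k = j_1 > j_2 > ⋯ > j_ℓ > j_{ℓ+1} = 0 are any indices with (i_m, j_m) ∈ T and (i_m, j_{m+1}) ∈ T for all m (such indices exist); this number is the area, i.e. the number of unit lattice boxes, below the staircase lattice path through the points (i_1,j_1),(i_1,j_2),(i_2,j_2),…,(i_ℓ,j_ℓ),(i_ℓ,0) — the path in T joining the leftmost element of T in row k to the top row — within the smallest rectangle containing it. -/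

import Mathlib

/-- A sequence `u 0, …, u a` of positive integers is unimodular if it increases
up to some index `k ≤ a` and decreases afterwards. -/
def IsUnimodular (a : ℕ) (u : ℕ → ℕ) : Prop :=
  (∀ i, i ≤ a → 0 < u i) ∧
  ∃ k, k ≤ a ∧ (∀ i j, i ≤ j → j ≤ k → u i ≤ u j) ∧
    (∀ i j, k ≤ i → i ≤ j → j ≤ a → u j ≤ u i)

/-- The stack set of the sequence `u 0, …, u a`: the point in column `i` and
row `j` (rows increasing downward) belongs to it iff `i ≤ a` and `j < u i`. -/
def stackSet (a : ℕ) (u : ℕ → ℕ) : Set (ℕ × ℕ) :=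
  {p | p.1 ≤ a ∧ p.2 < u p.1}

/-- Two points `p, q` are `U`-incompatible if one is strictly southwest or strictly
northeast of the other and the whole rectangle spanned by them lies inside `U`. -/
def Incompat (U : Set (ℕ × ℕ)) (p q : ℕ × ℕ) : Prop :=
  ((p.1 < q.1 ∧ q.2 < p.2) ∨ (q.1 < p.1 ∧ p.2 < q.2)) ∧
  ∀ k l : ℕ, min p.1 q.1 ≤ k → k ≤ max p.1 q.1 → min p.2 q.2 ≤ l → l ≤ max p.2 q.2 →
    (k, l) ∈ U

/-- `U`-compatibility. -/
def Compat (U : Set (ℕ × ℕ)) (p q : ℕ × ℕ) : Prop := ¬ Incompat U p q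

/-- A `U`-tree is a maximal (under inclusion) pairwise `U`-compatible subset of `U`. -/
def IsUTree (U T : Set (ℕ × ℕ)) : Prop :=
  T ⊆ U ∧ T.Pairwise (Compat U) ∧
    ∀ T' : Set (ℕ × ℕ), T' ⊆ U → T'.Pairwise (Compat U) → T ⊆ T' → T' = T

/-- A height function `h` on `U` is non-crossing if for every rectangle with its four
corners in `U`, the sum of the heights of the upper-left and lower-right corners is
strictly bigger than the sum of the heights of the lower-left and upper-right corners. -/
def NonCrossing (U : Set (ℕ × ℕ)) (h : ℕ × ℕ → ℝ) : Prop :=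
  ∀ i i' j j' : ℕ, i < i' → j < j' → (i, j) ∈ U → (i, j') ∈ U → (i', j) ∈ U →
    (i', j') ∈ U → h (i, j') + h (i', j) < h (i, j) + h (i', j')

/-- The polyhedral cell `g(A) ⊆ ℝ^{b+1}` associated to a subset `A` of `U` and a height
function `h`: the set of `y` with `y_0 = 0` and `y_j − h(i,j) ≤ y_{j'} − h(i,j')` for
every `(i,j) ∈ A` and every `j'` with `(i,j') ∈ U`. -/
def gSet (b : ℕ) (U A : Set (ℕ × ℕ)) (h : ℕ × ℕ → ℝ) : Set (Fin (b + 1) → ℝ) :=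
  {y | y 0 = 0 ∧ ∀ (i : ℕ) (j j' : Fin (b + 1)),
    (i, (j : ℕ)) ∈ A → (i, (j' : ℕ)) ∈ U →
      y j - h (i, (j : ℕ)) ≤ y j' - h (i, (j' : ℕ))}

/-- A chain of corners of the staircase path in `T` joining row `k` to row `0`: columns
`I 1 ≥ I 2 ≥ ⋯ ≥ I L` and rows `k = J 1 > J 2 > ⋯ > J L > J (L+1) = 0` with
`(I m, J m) ∈ T` (bottom corners) and `(I m, J (m+1)) ∈ T` (top corners) for all
`1 ≤ m ≤ L`. -/
def ChainIn (T : Set (ℕ × ℕ)) (k L : ℕ) (I J : ℕ → ℕ) : Prop :=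
  1 ≤ L ∧ J 1 = k ∧ J (L + 1) = 0 ∧
  (∀ m, 1 ≤ m → m + 1 ≤ L → I (m + 1) ≤ I m) ∧
  (∀ m, 1 ≤ m → m ≤ L → J (m + 1) < J m) ∧
  (∀ m, 1 ≤ m → m ≤ L → (I m, J m) ∈ T ∧ (I m, J (m + 1)) ∈ T)

/-- In a stack set, incompatibility only has to be tested on the bottom row of the
spanned rectangle. -/
theorem incompat_stackSet_iff {a : ℕ} {u : ℕ → ℕ} {x y x' y' : ℕ} :
    Incompat (stackSet a u) (x, y) (x', y') ↔
      (x < x' ∧ y' < y ∧ x' ≤ a ∧ ∀ c, x ≤ c → c ≤ x' → y < u c) ∨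
      (x' < x ∧ y < y' ∧ x ≤ a ∧ ∀ c, x' ≤ c → c ≤ x → y' < u c) := by
  simp only [Incompat, stackSet, Set.mem_ofPred_eq]
  constructor
  · rintro ⟨⟨h1, h2⟩ | ⟨h1, h2⟩, h⟩
    · exact Or.inl ⟨h1, h2, (h x' y' (by omega) (by omega) (by omega) (by omega)).1,
        fun c hc hc' => (h c y (by omega) (by omega) (by omega) (by omega)).2⟩
    · exact Or.inr ⟨h1, h2, (h x y (by omega) (by omega) (by omega) (by omega)).1,
        fun c hc hc' => (h c y' (by omega) (by omega) (by omega) (by omega)).2⟩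
  · rintro (⟨h1, h2, h3, h⟩ | ⟨h1, h2, h3, h⟩)
    · refine ⟨Or.inl ⟨h1, h2⟩, fun c l hc hc' hl hl' => ⟨by omega, ?_⟩⟩
      have := h c (by omega) (by omega)
      omega
    · refine ⟨Or.inr ⟨h1, h2⟩, fun c l hc hc' hl hl' => ⟨by omega, ?_⟩⟩
      have := h c (by omega) (by omega)
      omega

theorem Incompat.symm {U : Set (ℕ × ℕ)} {p q : ℕ × ℕ} (h : Incompat U p q) :
    Incompat U q p := by
  refine ⟨h.1.symm, fun c l hc hc' hl hl' => h.2 c l ?_ ?_ ?_ ?_⟩ <;> omega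

theorem not_incompat_self {U : Set (ℕ × ℕ)} (p : ℕ × ℕ) : ¬ Incompat U p p := by
  rintro ⟨h | h, -⟩ <;> omega

/-- Points of a `U`-tree are pairwise compatible. -/
theorem IsUTree.not_incompat {U T : Set (ℕ × ℕ)} (hT : IsUTree U T) {p q : ℕ × ℕ}
    (hp : p ∈ T) (hq : q ∈ T) : ¬ Incompat U p q := by
  rcases eq_or_ne p q with rfl | hne
  · exact not_incompat_self p
  · exact hT.2.1 hp hq hne

/-- By maximality, a point compatible with a whole `U`-tree belongs to it. -/
theorem IsUTree.mem_of_forall {U T : Set (ℕ × ℕ)} (hT : IsUTree U T) {p : ℕ × ℕ}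
    (hp : p ∈ U) (h : ∀ q ∈ T, ¬ Incompat U q p) : p ∈ T := by
  have key := hT.2.2 (insert p T) (Set.insert_subset hp hT.1)
    (hT.2.1.insert fun q hq _ => ⟨fun hi => h q hq hi.symm, h q hq⟩) (Set.subset_insert p T)
  exact key ▸ Set.mem_insert p T

/-- A `U`-tree meets every nonempty row of the stack set. -/
theorem IsUTree.exists_mem_row {a : ℕ} {u : ℕ → ℕ} {T : Set (ℕ × ℕ)}
    (hT : IsUTree (stackSet a u) T) {k c : ℕ} (hc : (c, k) ∈ stackSet a u) :
    ∃ i, (i, k) ∈ T := by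
  classical
  -- columns in which row `k` is not blocked from the north-east
  let P : ℕ → Prop := fun i => (i, k) ∈ stackSet a u ∧
    ∀ x' y', (x', y') ∈ T → i < x' → y' < k → ∃ c, i ≤ c ∧ c ≤ x' ∧ u c ≤ k
  have hP : ∃ i, P i := by
    let r := Nat.findGreatest (fun x => k < u x) a
    have hr : k < u r := Nat.findGreatest_spec (P := fun x => k < u x) hc.1 hc.2
    refine ⟨r, ⟨Nat.findGreatest_le a, hr⟩, fun x' y' hq hx _ => ⟨x', hx.le, le_rfl, ?_⟩⟩
    exact not_lt.1 (Nat.findGreatest_is_greatest (P := fun x => k < u x) hx (hT.1 hq).1)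
  obtain ⟨hiU, hi⟩ := Nat.find_spec hP
  have hmin : ∀ x, x < Nat.find hP → ¬ P x := fun x => Nat.find_min hP
  generalize Nat.find hP = i at hiU hi hmin
  refine ⟨i, hT.mem_of_forall hiU ?_⟩
  rintro ⟨x, y⟩ hq hinc
  rw [incompat_stackSet_iff] at hinc
  rcases hinc with ⟨h1, h2, h3, h4⟩ | ⟨h1, h2, h3, h4⟩
  · refine hmin x h1 ⟨⟨by omega, h2.trans (h4 x le_rfl h1.le)⟩, fun x' y' hq' hx hy => ?_⟩
    by_cases hx' : x' ≤ i
    · refine absurd (incompat_stackSet_iff.2 (Or.inl ⟨hx, hy.trans h2, by omega, ?_⟩))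
        (hT.not_incompat hq hq')
      exact fun c hc hc' => h4 c hc (by omega)
    · obtain ⟨c, hc1, hc2, hc3⟩ := hi x' y' hq' (by omega) hy
      exact ⟨c, by omega, hc2, hc3⟩
  · obtain ⟨c, hc1, hc2, hc3⟩ := hi x y hq h1 h2
    exact absurd (h4 c hc1 hc2) (by omega)

/-- The leftmost element of a `U`-tree in a row other than the top one has an element of
the tree above it in its column. -/
theorem IsUTree.exists_mem_above {a : ℕ} {u : ℕ → ℕ} {T : Set (ℕ × ℕ)}
    (hT : IsUTree (stackSet a u) T) {i k : ℕ} (hk : 1 ≤ k) (hik : (i, k) ∈ T)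
    (hleft : ∀ x, x < i → (x, k) ∉ T) : ∃ j, j < k ∧ (i, j) ∈ T := by
  classical
  obtain ⟨hia, hiu⟩ : i ≤ a ∧ k < u i := hT.1 hik
  -- `Q y` says that row `y` meets the tree to the left of `i`, in sight of column `i`
  let Q : ℕ → Prop := fun y => ∃ x, x < i ∧ (x, y) ∈ T ∧ ∀ c, x ≤ c → c ≤ i → y < u c
  have hQ : ∀ y, Q y → y < k := by
    rintro y ⟨x, hx, hxy, h⟩
    rcases lt_trichotomy y k with hlt | rfl | hgt
    · exact hlt
    · exact absurd hxy (hleft x hx)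
    · exact absurd (incompat_stackSet_iff.2 (Or.inl ⟨hx, hgt, hia, h⟩))
        (hT.not_incompat hxy hik)
  have hj : ∃ j, j < k ∧ (j = 0 ∨ Q j) ∧ ∀ y, Q y → y ≤ j := by
    by_cases h : ∃ y, Q y
    · obtain ⟨y, hy⟩ := h
      have hs : Q (Nat.findGreatest Q k) := Nat.findGreatest_spec (hQ y hy).le hy
      exact ⟨_, hQ _ hs, Or.inr hs, fun y hy => Nat.le_findGreatest (hQ y hy).le hy⟩
    · exact ⟨0, hk, Or.inl rfl, fun y hy => absurd ⟨y, hy⟩ h⟩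
  obtain ⟨j, hjk, hj, hmax⟩ := hj
  refine ⟨j, hjk, hT.mem_of_forall ⟨hia, hjk.trans hiu⟩ ?_⟩
  rintro ⟨x', y'⟩ hq hinc
  rw [incompat_stackSet_iff] at hinc
  rcases hinc with ⟨h1, h2, h3, h4⟩ | ⟨h1, h2, h3, h4⟩
  · exact absurd (hmax y' ⟨x', h1, hq, h4⟩) (by omega)
  · rcases hj with rfl | ⟨x, hx, hxj, h⟩
    · omega
    · refine hT.not_incompat hxj hq (incompat_stackSet_iff.2
        (Or.inl ⟨hx.trans h1, h2, h3, fun c hc hc' => ?_⟩))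
      rcases le_total c i with hci | hci
      · exact h c hc hci
      · exact h4 c hci hc'

/-- A column segment of `T` from row `k` to row `0` is a chain of length one. -/
theorem ChainIn.single {T : Set (ℕ × ℕ)} {i k : ℕ} (hk : 1 ≤ k) (hik : (i, k) ∈ T)
    (hi0 : (i, 0) ∈ T) : ChainIn T k 1 (fun _ => i) (fun m => if m = 1 then k else 0) := by
  refine ⟨le_rfl, rfl, rfl, fun _ _ _ => le_rfl, fun m h1 h2 => ?_, fun m h1 h2 => ?_⟩
  · obtain rfl : m = 1 := by omega
    simpa using Nat.pos_of_ne_zero (by omega)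
  · obtain rfl : m = 1 := by omega
    simpa using ⟨hik, hi0⟩

/-- Prepending a column segment to a chain. -/
theorem ChainIn.cons {T : Set (ℕ × ℕ)} {i j k L : ℕ} {I J : ℕ → ℕ} (h : ChainIn T j L I J)
    (hjk : j < k) (hI : I 1 ≤ i) (hik : (i, k) ∈ T) (hij : (i, j) ∈ T) :
    ChainIn T k (L + 1) (fun m => if m = 1 then i else I (m - 1))
      (fun m => if m = 1 then k else J (m - 1)) := by
  obtain ⟨hL, hJ1, hJL, hImono, hJanti, hmem⟩ := h
  refine ⟨by omega, rfl, ?_, fun m h1 h2 => ?_, fun m h1 h2 => ?_, fun m h1 h2 => ?_⟩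
  · simpa using hJL
  all_goals
    obtain ⟨m, rfl⟩ : ∃ n, m = n + 1 := ⟨m - 1, by omega⟩
    rcases Nat.eq_zero_or_pos m with rfl | hm
  · simpa using hI
  · simpa [hm.ne'] using hImono m hm (by omega)
  · simpa [hJ1] using hjk
  · simpa [hm.ne'] using hJanti m hm (by omega)
  · simpa [hJ1] using ⟨hik, hij⟩
  · simpa [hm.ne'] using hmem m hm (by omega)

/-- Every element of a `U`-tree outside the top row has a staircase path in the tree from
its row to the top row which stays weakly to the left of it. -/
theorem IsUTree.exists_chainIn {a : ℕ} {u : ℕ → ℕ} {T : Set (ℕ × ℕ)}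
    (hT : IsUTree (stackSet a u) T) {k i : ℕ} (hk : 1 ≤ k) (hik : (i, k) ∈ T) :
    ∃ (L : ℕ) (I J : ℕ → ℕ), ChainIn T k L I J ∧ I 1 ≤ i := by
  classical
  induction k using Nat.strong_induction_on generalizing i with
  | _ k ih =>
    have hrow : ∃ x, (x, k) ∈ T := ⟨i, hik⟩
    have hle : Nat.find hrow ≤ i := Nat.find_min' hrow hik
    have hmem := Nat.find_spec hrow
    obtain ⟨j, hjk, hj⟩ := hT.exists_mem_above hk hmem fun x => Nat.find_min hrow
    rcases Nat.eq_zero_or_pos j with rfl | hj0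
    · exact ⟨_, _, _, ChainIn.single hk hmem hj, hle⟩
    · obtain ⟨L, I, J, hc, hI⟩ := ih j hjk hj0 hj
      exact ⟨_, _, _, hc.cons hjk hI hmem hj, by simpa using hle⟩

/-- The canonical height function is non-crossing on every set. -/
theorem nonCrossing_mul (U : Set (ℕ × ℕ)) : NonCrossing U (fun p => (p.1 * p.2 : ℝ)) := by
  intro i i' j j' hi hj _ _ _ _
  have hi' : (i : ℝ) < i' := by exact_mod_cast hi
  have hj' : (j : ℝ) < j' := by exact_mod_cast hj
  have := mul_pos (sub_pos.2 hi') (sub_pos.2 hj')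
  dsimp only
  linarith

/-- If `(i, j)` and `(i, j')` both lie in `A`, then a point `y` of `g(A)` for the canonical
height function satisfies `y_j − y_{j'} = i (j − j')`. -/
theorem sub_eq_of_mem_gSet {b : ℕ} {U A : Set (ℕ × ℕ)} (hA : A ⊆ U) {y : Fin (b + 1) → ℝ}
    (hy : y ∈ gSet b U A (fun p => (p.1 * p.2 : ℝ))) {i : ℕ} {j j' : Fin (b + 1)}
    (hj : (i, (j : ℕ)) ∈ A) (hj' : (i, (j' : ℕ)) ∈ A) :
    y j - y j' = (i : ℝ) * (((j : ℕ) : ℝ) - ((j' : ℕ) : ℝ)) := by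
  have h1 := hy.2 i j j' hj (hA hj')
  have h2 := hy.2 i j' j hj' (hA hj)
  dsimp only at h1 h2
  linarith

/-- The coordinate `y_k` of a point of `g(T)` is read off from any chain of `T` starting in
row `k`. -/
theorem ChainIn.eq_sum {b k L : ℕ} {U T : Set (ℕ × ℕ)} {I J : ℕ → ℕ} (h : ChainIn T k L I J)
    (hTU : T ⊆ U) (hU : ∀ p ∈ U, p.2 < b + 1) {y : Fin (b + 1) → ℝ}
    (hy : y ∈ gSet b U T (fun p => (p.1 * p.2 : ℝ))) (hk : k < b + 1) :
    y ⟨k, hk⟩ = ∑ m ∈ Finset.Icc 1 L, (I m : ℝ) * ((J m : ℝ) - (J (m + 1) : ℝ)) := by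
  obtain ⟨hL, hJ1, hJL, -, -, hmem⟩ := h
  have hsum : ∀ m ∈ Finset.Icc 1 L, (I m : ℝ) * ((J m : ℝ) - (J (m + 1) : ℝ)) =
      y (Fin.ofNat (b + 1) (J m)) - y (Fin.ofNat (b + 1) (J (m + 1))) := by
    intro m hm
    obtain ⟨hm1, hm2⟩ := Finset.mem_Icc.1 hm
    obtain ⟨hb, ht⟩ := hmem m hm1 hm2
    have hb' : J m % (b + 1) = J m := Nat.mod_eq_of_lt (hU _ (hTU hb))
    have ht' : J (m + 1) % (b + 1) = J (m + 1) := Nat.mod_eq_of_lt (hU _ (hTU ht))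
    have := sub_eq_of_mem_gSet hTU hy (i := I m) (j := Fin.ofNat (b + 1) (J m))
      (j' := Fin.ofNat (b + 1) (J (m + 1))) (by simpa [hb'] using hb) (by simpa [ht'] using ht)
    simpa [hb', ht'] using this.symm
  have hstart : Fin.ofNat (b + 1) (J 1) = ⟨k, hk⟩ := by
    ext
    simp [hJ1, Nat.mod_eq_of_lt hk]
  have hend : Fin.ofNat (b + 1) (J (L + 1)) = 0 := by
    ext
    simp [hJL]
  rw [Finset.sum_congr rfl hsum, ← Finset.Ico_add_one_right_eq_Icc,
    ← neg_inj, ← Finset.sum_neg_distrib]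
  simp_rw [neg_sub]
  rw [Finset.sum_Ico_sub (fun m => y (Fin.ofNat (b + 1) (J m))) (by omega), hstart, hend,
    hy.1, zero_sub]

/-- The canonical height function `h(i,j) = i·j` on `U` is non-crossing,
and for every `U`-tree `T` and every `k ∈ {1,…,b}`, the unique point `y` of `g(T)`
satisfies `y_k = Σ_{m=1}^{L} i_m (j_m − j_{m+1})` for any chain of indices `L ≥ 1`,
`i_1 ≥ ⋯ ≥ i_L`, `k = j_1 > ⋯ > j_L > j_{L+1} = 0` with `(i_m, j_m) ∈ T` and
`(i_m, j_{m+1}) ∈ T` for all `m` (such indices exist); this number is the area below the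
staircase path of `T` joining the leftmost element of `T` in row `k` to the top row. -/
theorem canonical_realization (a b : ℕ) (u : ℕ → ℕ) (hu : IsUnimodular a u)
    (hub : ∀ i, i ≤ a → u i ≤ b + 1) (hmax : ∃ i, i ≤ a ∧ u i = b + 1) :
    NonCrossing (stackSet a u) (fun p => (p.1 * p.2 : ℝ)) ∧
    ∀ T : Set (ℕ × ℕ), IsUTree (stackSet a u) T →
      ∀ (k : ℕ) (_ : 1 ≤ k) (hk2 : k ≤ b),
        ∀ y ∈ gSet b (stackSet a u) T (fun p => (p.1 * p.2 : ℝ)),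
          (∃ (L : ℕ) (I J : ℕ → ℕ), ChainIn T k L I J) ∧
          ∀ (L : ℕ) (I J : ℕ → ℕ), ChainIn T k L I J →
            y ⟨k, by omega⟩ =
              ∑ m ∈ Finset.Icc 1 L, (I m : ℝ) * ((J m : ℝ) - (J (m + 1) : ℝ)) := by
  refine ⟨nonCrossing_mul _, fun T hT k hk1 hk2 y hy => ⟨?_, fun L I J h => ?_⟩⟩
  · obtain ⟨c, hca, hcu⟩ := hmax
    obtain ⟨i, hi⟩ := hT.exists_mem_row (k := k) (c := c) ⟨hca, show k < u c by omega⟩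
    obtain ⟨L, I, J, h, -⟩ := hT.exists_chainIn hk1 hi
    exact ⟨L, I, J, h⟩
  · exact h.eq_sum hT.1 (fun p hp => hp.2.trans_le (hub p.1 hp.1)) hy _
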